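/- Every finite abelian non-cyclic group that is generated by two elements and is not isomorphic to Z_2 × Z_2 admits an oriented m-semiregular representation (OmSR) of valency two for every integer m ≥ 2. -/

import Mathlib

/-- The arc relation of the `m`-Cayley digraph `Cay(G, T_{i,j} : i,j ∈ Z_m)`:
there is an arc from `(g,i)` to `(t*g, j)` for each `t ∈ T i j`. -/
def mCayleyArc {G : Type*} [Group G] {m : ℕ} (T : ZMod m → ZMod m → Set G) :
    G × ZMod m → G × ZMod m → Prop :=
  fun x y => ∃ t ∈ T x.2 y.2, y.1 = t * x.1

/-- A permutation `σ` of the vertex set is an automorphism of the digraph with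
arc relation `A` if it preserves the arc relation. -/
def IsDigraphAuto {V : Type*} (A : V → V → Prop) (σ : Equiv.Perm V) : Prop :=
  ∀ x y : V, A (σ x) (σ y) ↔ A x y

/-- A digraph is oriented if there are no loops and no pair of oppositely
directed arcs between any two vertices. -/
def IsOrientedRel {V : Type*} (A : V → V → Prop) : Prop :=
  ∀ x y : V, A x y → ¬ A y x

/-- The right translation `R(h) : (g,i) ↦ (g*h, i)` on the vertex set `G × Z_m`. -/
def rightTransl {G : Type*} [Group G] (m : ℕ) (h : G) : Equiv.Perm (G × ZMod m) :=
  (Equiv.mulRight h).prodCongr (Equiv.refl (ZMod m))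

/-- `G` admits an oriented `m`-semiregular representation (OmSR) of valency two:
there are connection sets `T i j ⊆ G` such that the corresponding `m`-Cayley
digraph is oriented, every vertex has exactly two out-neighbours and exactly two
in-neighbours, and the full automorphism group consists exactly of the right
translations `R(h)`, `h ∈ G`. -/
def HasOmSRValencyTwo (G : Type*) [Group G] (m : ℕ) : Prop :=
  ∃ T : ZMod m → ZMod m → Set G,
    IsOrientedRel (mCayleyArc T) ∧
    (∀ x : G × ZMod m, {y | mCayleyArc T x y}.ncard = 2) ∧
    (∀ x : G × ZMod m, {y | mCayleyArc T y x}.ncard = 2) ∧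
    (∀ σ : Equiv.Perm (G × ZMod m),
      IsDigraphAuto (mCayleyArc T) σ ↔ ∃ h : G, σ = rightTransl m h)

section TwoColoured

variable {G : Type*} [CommGroup G] {m : ℕ}

/-- Loop voltages: `c` at level `0` and `a` at every other level. -/
def loopVoltage (m : ℕ) (a c : G) (i : ZMod m) : G := if i = 0 then c else a

/-- Step voltages: `b` on the steps from level `-1` to level `0` and `1` elsewhere. -/
def stepVoltage (m : ℕ) (b : G) (i : ZMod m) : G := if i + 1 = 0 then b else 1

/-- The connection sets with one loop arc and one step arc at each level. -/
def loopStepSets (m : ℕ) (a b c : G) (i j : ZMod m) : Set G :=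
  {t | (j = i ∧ t = loopVoltage m a c i) ∨ (j = i + 1 ∧ t = stepVoltage m b i)}

/-- The arc relation of the digraph built from `loopStepSets`. -/
abbrev loopStepArc (m : ℕ) (a b c : G) : G × ZMod m → G × ZMod m → Prop :=
  mCayleyArc (loopStepSets m a b c)

theorem loopStepArc_iff {a b c g h : G} {i j : ZMod m} :
    loopStepArc m a b c (g, i) (h, j) ↔
      (j = i ∧ h = loopVoltage m a c i * g) ∨ (j = i + 1 ∧ h = stepVoltage m b i * g) := by
  simp only [mCayleyArc, loopStepSets, Set.mem_ofPred_eq]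
  constructor
  · rintro ⟨t, ⟨h1, rfl⟩ | ⟨h1, rfl⟩, h2⟩
    · exact Or.inl ⟨h1, h2⟩
    · exact Or.inr ⟨h1, h2⟩
  · rintro (⟨h1, h2⟩ | ⟨h1, h2⟩)
    · exact ⟨_, Or.inl ⟨h1, rfl⟩, h2⟩
    · exact ⟨_, Or.inr ⟨h1, rfl⟩, h2⟩

theorem loopStepArc_loop (a b c g : G) (i : ZMod m) :
    loopStepArc m a b c (g, i) (loopVoltage m a c i * g, i) :=
  loopStepArc_iff.2 (Or.inl ⟨rfl, rfl⟩)

theorem loopStepArc_step (a b c g : G) (i : ZMod m) :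
    loopStepArc m a b c (g, i) (stepVoltage m b i * g, i + 1) :=
  loopStepArc_iff.2 (Or.inr ⟨rfl, rfl⟩)

theorem loopStepArc_oriented [Fact (1 < m)] {a b c : G} (ha : a ^ 2 ≠ 1) (hc : c ^ 2 ≠ 1)
    (hb : m = 2 → b ≠ 1) : IsOrientedRel (loopStepArc m a b c) := by
  rintro ⟨g, i⟩ ⟨h, j⟩ h1 h2
  rw [loopStepArc_iff] at h1 h2
  rcases h1 with ⟨rfl, rfl⟩ | ⟨rfl, rfl⟩
  · rcases h2 with ⟨-, h2⟩ | ⟨h2, -⟩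
    · rw [← mul_assoc, right_eq_mul, ← pow_two] at h2
      unfold loopVoltage at h2
      split_ifs at h2
      · exact hc h2
      · exact ha h2
    · simp at h2
  · rcases h2 with ⟨h2, -⟩ | ⟨h2, h3⟩
    · simp at h2
    · have h4 : ((2 : ℕ) : ZMod m) = 0 := by
        rw [add_assoc, left_eq_add] at h2
        push_cast
        linear_combination h2
      rw [ZMod.natCast_eq_zero_iff] at h4
      have hm : m = 2 := le_antisymm (Nat.le_of_dvd two_pos h4) (Fact.out : 1 < m)
      have hb' := hb hm
      subst hm
      rw [← mul_assoc, right_eq_mul] at h3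
      have hi : i = 0 ∨ i = 1 := by
        clear h2 h3
        revert i
        decide
      have h11 : (1 : ZMod 2) + 1 = 0 := rfl
      rcases hi with rfl | rfl <;> simp [stepVoltage, h11] at h3 <;> exact hb' h3

theorem ncard_loopStepArc_out [Fact (1 < m)] (a b c : G) (x : G × ZMod m) :
    {y | loopStepArc m a b c x y}.ncard = 2 := by
  obtain ⟨g, i⟩ := x
  rw [Set.ncard_eq_two]
  refine ⟨(loopVoltage m a c i * g, i), (stepVoltage m b i * g, i + 1), by simp, ?_⟩
  ext ⟨h, j⟩
  simp only [Set.mem_ofPred_eq, loopStepArc_iff, Set.mem_insert_iff, Set.mem_singleton_iff,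
    Prod.mk.injEq]
  tauto

theorem ncard_loopStepArc_in [Fact (1 < m)] (a b c : G) (x : G × ZMod m) :
    {y | loopStepArc m a b c y x}.ncard = 2 := by
  obtain ⟨g, i⟩ := x
  rw [Set.ncard_eq_two]
  refine ⟨((loopVoltage m a c i)⁻¹ * g, i), ((stepVoltage m b (i - 1))⁻¹ * g, i - 1),
    by simp [eq_comm (a := i)], ?_⟩
  ext ⟨h, j⟩
  simp only [Set.mem_ofPred_eq, loopStepArc_iff, Set.mem_insert_iff, Set.mem_singleton_iff,
    Prod.mk.injEq]
  constructor
  · rintro (⟨rfl, rfl⟩ | ⟨rfl, rfl⟩) <;> simp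
  · rintro (⟨rfl, rfl⟩ | ⟨rfl, rfl⟩) <;> simp

theorem isDigraphAuto_rightTransl {H : Type*} [Group H] (T : ZMod m → ZMod m → Set H) (h : H) :
    IsDigraphAuto (mCayleyArc T) (rightTransl m h) := by
  rintro ⟨g, i⟩ ⟨k, j⟩
  simp [mCayleyArc, rightTransl, ← mul_assoc]

theorem IsDigraphAuto.symm {V : Type*} {A : V → V → Prop} {σ : Equiv.Perm V}
    (hσ : IsDigraphAuto A σ) : IsDigraphAuto A σ.symm := fun x y => by
  simpa using (hσ (σ.symm x) (σ.symm y)).symm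

/-- Automorphisms preserving level `0` preserve every level. -/
theorem IsDigraphAuto.snd_eq [Fact (1 < m)] {a b c : G}
    (h0 : ∀ σ, IsDigraphAuto (loopStepArc m a b c) σ → ∀ g, (σ (g, 0)).2 = 0)
    {σ : Equiv.Perm (G × ZMod m)} (hσ : IsDigraphAuto (loopStepArc m a b c) σ)
    (x : G × ZMod m) : (σ x).2 = x.2 := by
  have key : ∀ k : ℕ, ∀ σ, IsDigraphAuto (loopStepArc m a b c) σ →
      ∀ g, (σ (g, (k : ZMod m))).2 = k := by
    intro k
    induction k with
    | zero => simpa using h0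
    | succ k ih =>
      intro σ hσ g
      have harc := (hσ _ _).2 (loopStepArc_step a b c ((stepVoltage m b (k : ZMod m))⁻¹ * g) k)
      rw [mul_inv_cancel_left] at harc
      have hk := ih σ hσ ((stepVoltage m b (k : ZMod m))⁻¹ * g)
      rcases hy : σ ((stepVoltage m b (k : ZMod m))⁻¹ * g, (k : ZMod m)) with ⟨p, q⟩
      rcases hz : σ (g, (k : ZMod m) + 1) with ⟨r, t⟩
      rw [hy] at hk
      simp only at hk
      subst hk
      rw [hy, hz, loopStepArc_iff] at harc
      push_cast
      rw [hz]
      rcases harc with ⟨rfl, -⟩ | ⟨rfl, -⟩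
      · have := ih σ.symm hσ.symm r
        rw [← hz] at this
        simp at this
      · rfl
  have : NeZero m := ⟨by have := (Fact.out : 1 < m); omega⟩
  obtain ⟨g, i⟩ := x
  have := key i.val σ hσ g
  rwa [ZMod.natCast_zmod_val] at this

theorem hasOmSRValencyTwo_of_level_zero [Fact (1 < m)] {a b c : G} (ha : a ^ 2 ≠ 1)
    (hc : c ^ 2 ≠ 1) (hb : m = 2 → b ≠ 1) (hgen : Subgroup.closure {a, c} = ⊤)
    (h0 : ∀ σ, IsDigraphAuto (loopStepArc m a b c) σ → ∀ g, (σ (g, 0)).2 = 0) :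
    HasOmSRValencyTwo G m := by
  refine ⟨loopStepSets m a b c, loopStepArc_oriented ha hc hb, ncard_loopStepArc_out a b c,
    ncard_loopStepArc_in a b c, fun σ => ⟨fun hσ => ?_, ?_⟩⟩
  swap
  · rintro ⟨h, rfl⟩
    exact isDigraphAuto_rightTransl _ h
  have hlev := hσ.snd_eq h0
  set φ : ZMod m → G → G := fun i g => (σ (g, i)).1 * g⁻¹ with hφ
  have hσφ : ∀ g i, σ (g, i) = (φ i g * g, i) := fun g i =>
    Prod.ext (by simp [hφ]) (hlev (g, i))
  have hloop : ∀ i g, φ i (loopVoltage m a c i * g) = φ i g := by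
    intro i g
    have harc := (hσ _ _).2 (loopStepArc_loop a b c g i)
    rw [hσφ, hσφ] at harc
    replace harc := loopStepArc_iff.1 harc
    rcases harc with ⟨-, h⟩ | ⟨h, -⟩
    · rw [mul_left_comm, mul_right_inj, mul_left_inj] at h
      exact h
    · simp at h
  have hstep : ∀ i g, φ (i + 1) (stepVoltage m b i * g) = φ i g := by
    intro i g
    have harc := (hσ _ _).2 (loopStepArc_step a b c g i)
    rw [hσφ, hσφ] at harc
    replace harc := loopStepArc_iff.1 harc
    rcases harc with ⟨h, -⟩ | ⟨-, h⟩
    · simp at h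
    · rw [mul_left_comm, mul_right_inj, mul_left_inj] at h
      exact h
  have : NeZero m := ⟨by have := (Fact.out : 1 < m); omega⟩
  have hnat : ∀ k : ℕ, k < m → φ k = φ 0 := by
    intro k
    induction k with
    | zero => simp
    | succ k ih =>
      intro hk
      rw [← ih (by omega)]
      ext g
      have hne : (k : ZMod m) + 1 ≠ 0 := by
        intro h
        have h' : ((k + 1 : ℕ) : ZMod m) = 0 := by push_cast; exact h
        rw [ZMod.natCast_eq_zero_iff] at h'
        exact absurd (Nat.le_of_dvd (Nat.succ_pos k) h') (by omega)
      have := hstep k g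
      rw [stepVoltage, if_neg hne, one_mul] at this
      push_cast
      exact this
  have hlevel : ∀ i, φ i = φ 0 := fun i => by
    have := hnat i.val (ZMod.val_lt i)
    rwa [ZMod.natCast_zmod_val] at this
  have hinv : ∀ k g, φ 0 (k * g) = φ 0 g := by
    intro k
    have hk : k ∈ Subgroup.closure {a, c} := hgen ▸ Subgroup.mem_top k
    induction hk using Subgroup.closure_induction with
    | mem x hx =>
      intro g
      rcases hx with rfl | rfl
      · have := hloop 1 g
        rwa [hlevel, loopVoltage, if_neg one_ne_zero] at this
      · simpa [loopVoltage] using hloop 0 g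
    | one => simp
    | mul x y _ _ hx hy => intro g; rw [mul_assoc, hx, hy]
    | inv x _ hx => intro g; rw [← hx (x⁻¹ * g), mul_inv_cancel_left]
  refine ⟨φ 0 1, Equiv.ext ?_⟩
  rintro ⟨g, i⟩
  rw [hσφ, hlevel]
  have := hinv g 1
  rw [mul_one] at this
  simp [rightTransl, this, mul_comm]

/-- Two distinct out-neighbours of `x` have a common out-neighbour. -/
def HasOutSquare {V : Type*} (A : V → V → Prop) (x : V) : Prop :=
  ∃ y z w, y ≠ z ∧ A x y ∧ A x z ∧ A y w ∧ A z w

/-- Every arc leaving `x` starts a directed closed walk of length three. -/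
def AllOutTriangles {V : Type*} (A : V → V → Prop) (x : V) : Prop :=
  ∀ y, A x y → ∃ z, A y z ∧ A z x

theorem IsDigraphAuto.hasOutSquare {V : Type*} {A : V → V → Prop} {σ : Equiv.Perm V}
    (hσ : IsDigraphAuto A σ) {x : V} (h : HasOutSquare A x) : HasOutSquare A (σ x) := by
  obtain ⟨y, z, w, h1, h2, h3, h4, h5⟩ := h
  exact ⟨σ y, σ z, σ w, σ.injective.ne h1, (hσ _ _).2 h2, (hσ _ _).2 h3, (hσ _ _).2 h4,
    (hσ _ _).2 h5⟩

theorem IsDigraphAuto.hasOutSquare_iff {V : Type*} {A : V → V → Prop} {σ : Equiv.Perm V}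
    (hσ : IsDigraphAuto A σ) {x : V} : HasOutSquare A (σ x) ↔ HasOutSquare A x :=
  ⟨fun h => by simpa using hσ.symm.hasOutSquare h, hσ.hasOutSquare⟩

theorem IsDigraphAuto.allOutTriangles {V : Type*} {A : V → V → Prop} {σ : Equiv.Perm V}
    (hσ : IsDigraphAuto A σ) {x : V} (h : AllOutTriangles A x) : AllOutTriangles A (σ x) := by
  intro y hy
  obtain ⟨z, hz, hz'⟩ := h (σ.symm y) (by simpa using (hσ.symm _ _).2 hy)
  exact ⟨σ z, by simpa using (hσ _ _).2 hz, (hσ _ _).2 hz'⟩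

theorem hasOutSquare_iff_voltage [Fact (1 < m)] (a b c g : G) (i : ZMod m) :
    HasOutSquare (loopStepArc m a b c) (g, i) ↔
      loopVoltage m a c i = loopVoltage m a c (i + 1) ∨
      ((2 : ZMod m) = 0 ∧
        loopVoltage m a c i ^ 2 = stepVoltage m b i * stepVoltage m b (i + 1)) := by
  have hsq : HasOutSquare (loopStepArc m a b c) (g, i) ↔
      ∃ w, loopStepArc m a b c (loopVoltage m a c i * g, i) w ∧
        loopStepArc m a b c (stepVoltage m b i * g, i + 1) w := by
    constructor
    · rintro ⟨⟨y, j⟩, ⟨z, k⟩, w, h1, h2, h3, h4, h5⟩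
      rw [loopStepArc_iff] at h2 h3
      rcases h2 with ⟨rfl, rfl⟩ | ⟨rfl, rfl⟩ <;> rcases h3 with ⟨rfl, rfl⟩ | ⟨rfl, rfl⟩
      · exact absurd rfl h1
      · exact ⟨w, h4, h5⟩
      · exact ⟨w, h5, h4⟩
      · exact absurd rfl h1
    · rintro ⟨w, h1, h2⟩
      exact ⟨_, _, w, by simp, loopStepArc_loop a b c g i, loopStepArc_step a b c g i, h1, h2⟩
  rw [hsq]
  constructor
  · rintro ⟨⟨w, j⟩, h1, h2⟩
    rw [loopStepArc_iff] at h1 h2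
    rcases h1 with ⟨rfl, rfl⟩ | ⟨rfl, rfl⟩
    · rcases h2 with ⟨h2, -⟩ | ⟨h2, h3⟩
      · simp at h2
      · refine Or.inr ⟨by linear_combination -h2, ?_⟩
        rw [← mul_assoc, ← mul_assoc, mul_left_inj] at h3
        rw [pow_two, h3, mul_comm]
    · rcases h2 with ⟨-, h3⟩ | ⟨h2, -⟩
      · rw [mul_left_comm, mul_left_inj] at h3
        exact Or.inl h3
      · simp at h2
  · rintro (h | ⟨h2, h⟩)
    · refine ⟨_, loopStepArc_step a b c _ i, loopStepArc_iff.2 (Or.inl ⟨rfl, ?_⟩)⟩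
      rw [← h, mul_left_comm]
    · refine ⟨_, loopStepArc_loop a b c _ i, loopStepArc_iff.2 (Or.inr ⟨?_, ?_⟩)⟩
      · linear_combination -h2
      · rw [← mul_assoc, ← mul_assoc, ← pow_two, h, mul_comm (stepVoltage m b i)]

theorem hasOutSquare_iff_of_two_ne_zero [Fact (1 < m)] (h2 : (2 : ZMod m) ≠ 0) {a b c : G}
    (hac : a ≠ c) (x : G × ZMod m) :
    HasOutSquare (loopStepArc m a b c) x ↔ x.2 ≠ 0 ∧ x.2 + 1 ≠ 0 := by
  obtain ⟨g, i⟩ := x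
  rw [hasOutSquare_iff_voltage]
  simp only [h2, false_and, or_false, loopVoltage]
  by_cases hi : i = 0
  · subst hi
    simpa using hac.symm
  · by_cases hi' : i + 1 = 0 <;> simp [hi, hi', hac]

theorem level_zero_of_two_ne_zero [Fact (1 < m)] (h2 : (2 : ZMod m) ≠ 0) {a b c : G}
    (hac : a ≠ c) {σ : Equiv.Perm (G × ZMod m)}
    (hσ : IsDigraphAuto (loopStepArc m a b c) σ) (g : G) : (σ (g, 0)).2 = 0 := by
  by_contra hne
  have hsq := hasOutSquare_iff_of_two_ne_zero (b := b) h2 hac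
  have h1 : ¬ HasOutSquare (loopStepArc m a b c) (σ (g, 0)) := by
    rw [hσ.hasOutSquare_iff, hsq]
    simp
  have h3 : HasOutSquare (loopStepArc m a b c) (σ (stepVoltage m b 0 * g, 0 + 1)) := by
    rw [hσ.hasOutSquare_iff, hsq]
    simpa [one_add_one_eq_two] using h2
  have harc := (hσ _ _).2 (loopStepArc_step a b c g 0)
  rcases hy : σ (g, 0) with ⟨p, i⟩
  rcases hz : σ (stepVoltage m b 0 * g, 0 + 1) with ⟨q, j⟩
  rw [hy] at h1 hne harc
  rw [hz] at h3 harc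
  rw [hsq] at h1 h3
  rw [loopStepArc_iff] at harc
  simp only at h1 h3 hne
  rcases harc with ⟨rfl, -⟩ | ⟨rfl, -⟩
  · exact h1 h3
  · exact h1 ⟨hne, h3.1⟩

theorem level_zero_of_square {a c : G} (hac : a ≠ c) (ha : a ^ 3 = 1) (hc : c ^ 3 = 1)
    {σ : Equiv.Perm (G × ZMod 2)} (hσ : IsDigraphAuto (loopStepArc 2 a c⁻¹ c) σ) (g : G) :
    (σ (g, 0)).2 = 0 := by
  have : Fact (1 < 2) := ⟨one_lt_two⟩
  have h11 : (1 : ZMod 2) + 1 = 0 := rfl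
  have hinv : ∀ x : G, x ^ 3 = 1 → x ^ 2 = x⁻¹ := fun x hx => by
    rw [eq_inv_iff_mul_eq_one, ← pow_succ, hx]
  have h0 : HasOutSquare (loopStepArc 2 a c⁻¹ c) (σ (g, 0)) := by
    rw [hσ.hasOutSquare_iff, hasOutSquare_iff_voltage]
    exact Or.inr ⟨rfl, by simp [loopVoltage, stepVoltage, h11, hinv c hc]⟩
  rcases hy : σ (g, 0) with ⟨p, i⟩
  rw [hy] at h0
  have hi : i = 0 ∨ i = 1 := by
    clear h0 hy
    revert i
    decide
  rcases hi with rfl | rfl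
  · rfl
  · rw [hasOutSquare_iff_voltage] at h0
    rcases h0 with h0 | ⟨-, h0⟩
    · simp [loopVoltage, h11] at h0
      exact absurd h0 hac
    · simp [loopVoltage, stepVoltage, h11, hinv a ha] at h0
      exact absurd h0 hac

theorem level_zero_of_triangle {a c : G} (hac : a ≠ c) (ha : a ^ 3 ≠ 1)
    {σ : Equiv.Perm (G × ZMod 2)} (hσ : IsDigraphAuto (loopStepArc 2 a c⁻¹ c) σ) (g : G) :
    (σ (g, 0)).2 = 0 := by
  have h11 : (1 : ZMod 2) + 1 = 0 := rfl
  have h0 : AllOutTriangles (loopStepArc 2 a c⁻¹ c) (g, 0) := by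
    rintro ⟨h, j⟩ hy
    rw [loopStepArc_iff] at hy
    rcases hy with ⟨rfl, rfl⟩ | ⟨rfl, rfl⟩
    · refine ⟨_, loopStepArc_step _ _ _ _ _, loopStepArc_iff.2 (Or.inr ⟨rfl, ?_⟩)⟩
      simp [loopVoltage, stepVoltage, h11]
    · refine ⟨_, loopStepArc_step _ _ _ _ _, loopStepArc_iff.2 (Or.inl ⟨rfl, ?_⟩)⟩
      simp [loopVoltage, stepVoltage, h11]
  replace h0 := hσ.allOutTriangles h0
  rcases hy : σ (g, 0) with ⟨p, i⟩
  rw [hy] at h0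
  have hi : i = 0 ∨ i = 1 := by
    clear h0 hy
    revert i
    decide
  rcases hi with rfl | rfl
  · rfl
  · obtain ⟨⟨z, j⟩, h1, h2⟩ := h0 _ (loopStepArc_loop a c⁻¹ c p 1)
    rw [loopStepArc_iff] at h1 h2
    rcases h1 with ⟨rfl, rfl⟩ | ⟨rfl, rfl⟩
    · rcases h2 with ⟨-, h2⟩ | ⟨h2, -⟩
      · refine absurd ?_ ha
        simp only [loopVoltage, one_ne_zero, if_false, ← mul_assoc, right_eq_mul] at h2
        rw [← h2, pow_succ, pow_two]
      · simp at h2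
    · rcases h2 with ⟨h2, -⟩ | ⟨-, h2⟩
      · simp at h2
      · simp [loopVoltage, stepVoltage, h11, ← mul_assoc, right_eq_mul,
          inv_mul_eq_one] at h2
        exact absurd h2.symm hac

theorem hasOmSRValencyTwo_of_generators {a c : G} (ha : a ^ 2 ≠ 1) (hc : c ^ 2 ≠ 1)
    (hac : a ≠ c) (h3 : a ^ 3 = 1 → c ^ 3 = 1) (hgen : Subgroup.closure {a, c} = ⊤)
    (hm : 2 ≤ m) : HasOmSRValencyTwo G m := by
  have : Fact (1 < m) := ⟨hm⟩
  have hc1 : c⁻¹ ≠ 1 := by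
    rintro h
    rw [inv_eq_one] at h
    simp [h] at hc
  refine hasOmSRValencyTwo_of_level_zero (b := c⁻¹) ha hc (fun _ => hc1) hgen fun σ hσ g => ?_
  by_cases h2 : (2 : ZMod m) = 0
  · have hm2 : m = 2 := by
      have h2' : ((2 : ℕ) : ZMod m) = 0 := h2
      rw [ZMod.natCast_eq_zero_iff] at h2'
      exact le_antisymm (Nat.le_of_dvd two_pos h2') hm
    subst hm2
    by_cases ha3 : a ^ 3 = 1
    · exact level_zero_of_square hac ha3 (h3 ha3) hσ g
    · exact level_zero_of_triangle hac ha3 hσ g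
  · exact level_zero_of_two_ne_zero h2 hac hσ g

end TwoColoured

theorem isCyclic_of_closure_singleton {G : Type*} [Group G] {a : G}
    (h : Subgroup.closure {a} = ⊤) : IsCyclic G :=
  isCyclic_iff_exists_zpowers_eq_top.2 ⟨a, by rw [Subgroup.zpowers_eq_closure, h]⟩

/-- A non-cyclic commutative group generated by two elements of square one is a Klein four-group. -/
theorem isKleinFour_of_closure_pair {G : Type*} [CommGroup G] (hnc : ¬ IsCyclic G) {a b : G}
    (hgen : Subgroup.closure {a, b} = ⊤) (ha : a ^ 2 = 1) (hb : b ^ 2 = 1) : IsKleinFour G := by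
  classical
  have haa : a * a = 1 := by rw [← pow_two, ha]
  have hbb : b * b = 1 := by rw [← pow_two, hb]
  have hsq : ∀ x : G, x ^ 2 = 1 := by
    intro x
    have hx : x ∈ Subgroup.closure {a, b} := hgen ▸ Subgroup.mem_top x
    obtain ⟨i, j, rfl⟩ := Subgroup.mem_closure_pair.1 hx
    rw [mul_pow, ← zpow_natCast, ← zpow_natCast, zpow_comm a, zpow_comm b, zpow_natCast,
      zpow_natCast, ha, hb, one_zpow, one_zpow, one_mul]
  have hmem : ∀ x : G, x ∈ ({1, a, b, a * b} : Finset G) := by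
    intro x
    have hx : x ∈ Subgroup.closure {a, b} := hgen ▸ Subgroup.mem_top x
    simp only [Finset.mem_insert, Finset.mem_singleton]
    obtain ⟨i, j, rfl⟩ := Subgroup.mem_closure_pair.1 hx
    have hz : ∀ y : G, y * y = 1 → ∀ k : ℤ, y ^ k = 1 ∨ y ^ k = y := by
      intro y hy k
      rcases Int.even_or_odd' k with ⟨l, rfl | rfl⟩
      · left; rw [zpow_mul, zpow_two, hy, one_zpow]
      · right; rw [zpow_add, zpow_mul, zpow_two, hy, one_zpow, one_mul, zpow_one]
    rcases hz a haa i with h | h <;> rcases hz b hbb j with h' | h' <;> simp [h, h']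
  have ha1 : a ≠ 1 := by
    rintro rfl
    rw [Subgroup.closure_insert_one] at hgen
    exact hnc (isCyclic_of_closure_singleton hgen)
  have hb1 : b ≠ 1 := by
    rintro rfl
    rw [Set.pair_comm, Subgroup.closure_insert_one] at hgen
    exact hnc (isCyclic_of_closure_singleton hgen)
  have hab : a ≠ b := by
    rintro rfl
    rw [Set.pair_eq_singleton] at hgen
    exact hnc (isCyclic_of_closure_singleton hgen)
  have hab1 : a * b ≠ 1 := by
    intro h
    rw [mul_eq_one_iff_eq_inv, ← eq_inv_of_mul_eq_one_left hbb] at h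
    exact hab h
  have : Fintype G := ⟨{1, a, b, a * b}, hmem⟩
  refine ⟨?_, ?_⟩
  · rw [Nat.card_eq_fintype_card, ← Finset.card_univ, ← Finset.eq_univ_of_forall hmem]
    simp [Finset.card_insert_of_notMem, ha1.symm, hb1.symm, hab, hab1.symm, ha1, hb1]
  · have hdvd := Monoid.exponent_dvd_of_forall_pow_eq_one hsq
    rcases (Nat.dvd_prime Nat.prime_two).1 hdvd with h | h
    · rw [Monoid.exp_eq_one_iff] at h
      exact absurd (Subsingleton.elim a 1) ha1
    · exact h

theorem closure_pair_mul_left {G : Type*} [CommGroup G] (a b : G) :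
    Subgroup.closure {a, a * b} = Subgroup.closure {a, b} := by
  apply le_antisymm <;> rw [Subgroup.closure_le]
  · have ha : a ∈ Subgroup.closure {a, b} := Subgroup.subset_closure (by simp)
    have hb : b ∈ Subgroup.closure {a, b} := Subgroup.subset_closure (by simp)
    rintro x (rfl | rfl)
    · exact ha
    · exact mul_mem ha hb
  · have ha : a ∈ Subgroup.closure {a, a * b} := Subgroup.subset_closure (by simp)
    have hb : a * b ∈ Subgroup.closure {a, a * b} := Subgroup.subset_closure (by simp)
    rintro x (rfl | rfl)
    · exact ha
    · exact (Subgroup.mul_mem_cancel_left _ ha).1 hb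

/-- A non-cyclic commutative group generated by two elements that is not a Klein four-group is
generated by two elements whose squares are non-trivial. -/
theorem exists_closure_pair_sq_ne_one {G : Type*} [CommGroup G] (hnc : ¬ IsCyclic G)
    (hgen : ∃ a b : G, Subgroup.closure {a, b} = ⊤) (hk : ¬ IsKleinFour G) :
    ∃ a b : G, Subgroup.closure {a, b} = ⊤ ∧ a ^ 2 ≠ 1 ∧ b ^ 2 ≠ 1 := by
  obtain ⟨a, b, h⟩ := hgen
  wlog ha : a ^ 2 ≠ 1 generalizing a b
  · push Not at ha
    refine this b a (by rwa [Set.pair_comm]) fun hb => ?_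
    exact hk (isKleinFour_of_closure_pair hnc h ha hb)
  by_cases hb : b ^ 2 = 1
  · exact ⟨a, a * b, by rwa [closure_pair_mul_left], ha, by rwa [mul_pow, hb, mul_one]⟩
  · exact ⟨a, b, h, ha, hb⟩

/-- Every finite abelian non-cyclic group generated by two elements and not
isomorphic to `Z_2 × Z_2` admits an OmSR of valency two for every integer
`m ≥ 2`. -/
theorem abelian_noncyclic_omsr
    (G : Type*) [CommGroup G] [Fintype G] (hnc : ¬ IsCyclic G)
    (hgen : ∃ a b : G, Subgroup.closure {a, b} = ⊤)
    (hne : ¬ Nonempty (G ≃* Multiplicative (ZMod 2 × ZMod 2)))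
    (m : ℕ) (hm : 2 ≤ m) :
    HasOmSRValencyTwo G m := by
  have hk : ¬ IsKleinFour G := fun _ => hne IsKleinFour.nonempty_mulEquiv
  obtain ⟨a, c, h, ha, hc⟩ := exists_closure_pair_sq_ne_one hnc hgen hk
  wlog h3 : a ^ 3 = 1 → c ^ 3 = 1 generalizing a c
  · push Not at h3
    exact this c a (by rwa [Set.pair_comm]) hc ha fun hc3 => absurd hc3 h3.2
  refine hasOmSRValencyTwo_of_generators ha hc ?_ h3 h hm
  rintro rfl
  rw [Set.pair_eq_singleton] at h
  exact hnc (isCyclic_of_closure_singleton h)
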